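/- For every γ > 0 and every ε ∈ (0, 1/2) there exists a constant C > 0 such that the following holds: for all z ∈ ℂ with Im z > 0, ε ≤ |z| ≤ 1/ε and |1 − z| ≥ ε, all E ∈ ℝ with |E| ≤ 1/ε, and every invertible m ∈ Matrix (Fin 2) (Fin 2) ℂ such that T₁(m) and T₂(m) are invertible and m satisfies m⁻¹ − E•σ₁ − T₁(m)⁻¹ − T₂(m)⁻¹ + σ₁ ⬝ m ⬝ σ₁ = 0 together with m₂₂ = 4γ²z·m₁₁, one has ‖m‖ ≤ C and |det T₁(m)| ≥ 1/C. -/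

import Mathlib

open Matrix

noncomputable section

def sigma1 : Matrix (Fin 2) (Fin 2) ℂ := !![0, 1; 1, 0]

/-- `T₁(m) = m + !![−1/(γ²z), i/γ; −i/γ, 0]`. -/
def T1 (γ : ℝ) (z : ℂ) (m : Matrix (Fin 2) (Fin 2) ℂ) : Matrix (Fin 2) (Fin 2) ℂ :=
  m + !![-(1 / ((γ : ℂ) ^ 2 * z)), Complex.I / (γ : ℂ); -(Complex.I / (γ : ℂ)), 0]

/-- `T₂(m) = m + !![0, i/γ; −i/γ, −4]`. -/
def T2 (γ : ℝ) (m : Matrix (Fin 2) (Fin 2) ℂ) : Matrix (Fin 2) (Fin 2) ℂ :=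
  m + !![0, Complex.I / (γ : ℂ); -(Complex.I / (γ : ℂ)), -4]

/-- The ℓ²→ℓ² operator norm of a square complex matrix. -/
def opNorm {n : Type*} [Fintype n] [DecidableEq n] (A : Matrix n n ℂ) : ℝ :=
  ‖Matrix.toEuclideanCLM (𝕜 := ℂ) A‖

lemma opNorm_le_entries (m : Matrix (Fin 2) (Fin 2) ℂ) :
    opNorm m ≤ ‖m 0 0‖ + ‖m 0 1‖ + ‖m 1 0‖ + ‖m 1 1‖ := by
  unfold opNorm
  refine ContinuousLinearMap.opNorm_le_bound _ (by positivity) fun x => ?_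
  have hx : ∀ i, ‖x i‖ ≤ ‖x‖ := fun i => PiLp.norm_apply_le x i
  have hsum : ∀ y : EuclideanSpace ℂ (Fin 2), ‖y‖ ≤ ‖y 0‖ + ‖y 1‖ := by
    intro y
    rw [EuclideanSpace.norm_eq, Fin.sum_univ_two]
    refine Real.sqrt_le_iff.mpr ⟨by positivity, ?_⟩
    nlinarith [norm_nonneg (y 0), norm_nonneg (y 1), mul_nonneg (norm_nonneg (y 0)) (norm_nonneg (y 1))]
  have hi : ∀ i, (Matrix.toEuclideanCLM (𝕜 := ℂ) m x) i = m i 0 * x 0 + m i 1 * x 1 := by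
    intro i
    simp [Matrix.mulVec, dotProduct, Fin.sum_univ_two]
  have hb : ∀ i, ‖m i 0 * x 0 + m i 1 * x 1‖ ≤ (‖m i 0‖ + ‖m i 1‖) * ‖x‖ := by
    intro i
    refine (norm_add_le _ _).trans ?_
    rw [norm_mul, norm_mul, add_mul]
    gcongr <;> exact hx _
  refine (hsum _).trans ?_
  rw [hi, hi]
  have := hb 0
  have := hb 1
  nlinarith

set_option maxHeartbeats 2000000 in
/-- Step 1: `a` is bounded. -/
lemma step_a (L : ℝ) (hL : 2 ≤ L) (p q g a s D Δ K e : ℂ)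
    (hp : ‖p‖ ≤ L) (hq : ‖q‖ ≤ L) (hg : ‖g‖ ≤ L) (he : ‖e‖ ≤ L)
    (hp' : 1 ≤ L * ‖p‖) (hq' : 1 ≤ L * ‖q‖)
    (hD : D ≠ 0)
    (h1 : D = 4 * p * q * a ^ 2 - s ^ 2 / 4) (h2 : Δ = D - 4 * q * a - g)
    (h3 : K * p * a * Δ = -1) (h4 : K * D * Δ = D * Δ + Δ - 2 * D)
    (h5 : s * (2 - K) = 2 * e) : ‖a‖ ≤ 10 * L ^ 3 := by
  by_contra! hA
  have hLp : 0 < L := by linarith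
  have h6 : p * a * (Δ * (D + 1)) = 2 * (p * a) * D - D := by
    linear_combination (-p * a) * h4 + D * h3
  have hDpos : 0 < ‖D‖ := norm_pos_iff.mpr hD
  have hpa : 10 * L ^ 2 ≤ ‖p‖ * ‖a‖ := by
    have : 10 * L ^ 3 ≤ L * (‖p‖ * ‖a‖) := by nlinarith [norm_nonneg a]
    have : L * (10 * L ^ 2) ≤ L * (‖p‖ * ‖a‖) := by nlinarith
    exact le_of_mul_le_mul_left this hLp
  have hqa : 10 * L ^ 2 ≤ ‖q‖ * ‖a‖ := by
    have : 10 * L ^ 3 ≤ L * (‖q‖ * ‖a‖) := by nlinarith [norm_nonneg a]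
    have : L * (10 * L ^ 2) ≤ L * (‖q‖ * ‖a‖) := by nlinarith
    exact le_of_mul_le_mul_left this hLp
  have n6 : ‖p‖ * ‖a‖ * (‖Δ‖ * ‖D + 1‖) = ‖2 * (p * a) * D - D‖ := by
    rw [← h6]; simp [norm_mul]
  have hD1 : ‖D‖ - 1 ≤ ‖D + 1‖ := by
    have := norm_sub_le (D + 1) 1
    simp at this; linarith
  have hD1' : ‖D + 1‖ ≤ ‖D‖ + 1 := by
    have := norm_add_le D 1
    simpa using this
  have n6l : 2 * (‖p‖ * ‖a‖) * ‖D‖ - ‖D‖ ≤ ‖2 * (p * a) * D - D‖ := by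
    have := norm_sub_norm_le (2 * (p * a) * D) D
    simpa [norm_mul] using this
  have n6u : ‖2 * (p * a) * D - D‖ ≤ 2 * (‖p‖ * ‖a‖) * ‖D‖ + ‖D‖ := by
    have := norm_sub_le (2 * (p * a) * D) D
    simpa [norm_mul] using this
  have hL2 : 4 ≤ L ^ 2 := by nlinarith
  have hLL : 2 * L ≤ L ^ 2 := by nlinarith
  -- 1a
  have hbig : 1 ≤ ‖p‖ * ‖a‖ * ‖Δ‖ := by
    by_contra! hlt
    have hΔ : ‖Δ‖ ≤ 1 := by nlinarith [norm_nonneg Δ]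
    have hDl : 4 * (‖q‖ * ‖a‖) ≤ ‖D‖ + ‖Δ‖ + ‖g‖ := by
      have e1 : 4 * q * a = D - Δ - g := by rw [h2]; ring
      have := norm_sub_le (D - Δ) g
      have h' := norm_sub_le D Δ
      rw [← e1] at this
      simp [norm_mul] at this
      linarith
    have hD2 : 2 ≤ ‖D‖ := by nlinarith
    have : ‖p‖ * ‖a‖ * (‖Δ‖ * ‖D + 1‖) ≤ ‖D‖ + 1 := by
      calc _ = (‖p‖ * ‖a‖ * ‖Δ‖) * ‖D + 1‖ := by ring
        _ ≤ 1 * ‖D + 1‖ := by gcongr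
        _ ≤ _ := by linarith
    nlinarith
  have hK : ‖K‖ ≤ 1 := by
    have : ‖K‖ * (‖p‖ * ‖a‖ * ‖Δ‖) = 1 := by
      have := congrArg norm h3
      simp [norm_mul] at this
      linarith
    nlinarith [norm_nonneg K]
  have hs : ‖s‖ ≤ 2 * L := by
    have n5 := congrArg norm h5
    simp only [norm_mul, Complex.norm_ofNat] at n5
    have := norm_sub_norm_le 2 K
    simp only [Complex.norm_ofNat] at this
    nlinarith [norm_nonneg s]
  have hDl : 4 * (‖p‖ * ‖a‖) * (‖q‖ * ‖a‖) ≤ ‖D‖ + L ^ 2 := by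
    have e1 : 4 * (p * a) * (q * a) = D + s ^ 2 / 4 := by rw [h1]; ring
    have := norm_add_le D (s ^ 2 / 4)
    rw [← e1] at this
    simp [norm_mul] at this
    nlinarith [norm_nonneg s]
  have hΔl : ‖D‖ ≤ ‖Δ‖ + 4 * (‖q‖ * ‖a‖) + L := by
    have e1 : D = Δ + 4 * (q * a) + g := by rw [h2]; ring
    have := norm_add_le (Δ + 4 * (q * a)) g
    have h' := norm_add_le Δ (4 * (q * a))
    rw [← e1] at this
    simp [norm_mul] at h'
    linarith
  have hprod : 4 * (10 * L ^ 2) * (‖q‖ * ‖a‖) ≤ 4 * (‖p‖ * ‖a‖) * (‖q‖ * ‖a‖) := by gcongr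
  have hprod2 : 16 * (‖q‖ * ‖a‖) ≤ 4 * L ^ 2 * (‖q‖ * ‖a‖) := by nlinarith
  have hΔ7 : 7 ≤ ‖Δ‖ := by nlinarith
  have hD2 : 2 ≤ ‖D‖ := by nlinarith
  have hc : ‖p‖ * ‖a‖ * (‖Δ‖ * ‖D + 1‖) ≤ ‖p‖ * ‖a‖ * (3 * ‖D‖) := by nlinarith
  have hc2 := le_of_mul_le_mul_left hc (by nlinarith)
  nlinarith [norm_nonneg (D + 1)]

/-- Step 2: `s` is bounded. -/
lemma step_s (L : ℝ) (hL : 2 ≤ L) (p q g a s D Δ K e : ℂ)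
    (hp : ‖p‖ ≤ L) (hq : ‖q‖ ≤ L) (hg : ‖g‖ ≤ L) (he : ‖e‖ ≤ L)
    (hD : D ≠ 0) (hΔ : Δ ≠ 0)
    (h1 : D = 4 * p * q * a ^ 2 - s ^ 2 / 4) (h2 : Δ = D - 4 * q * a - g)
    (h4 : K * D * Δ = D * Δ + Δ - 2 * D)
    (h5 : s * (2 - K) = 2 * e) (ha : ‖a‖ ≤ 10 * L ^ 3) : ‖s‖ ≤ 50 * L ^ 4 := by
  by_contra! hS
  have hLp : 0 < L := by linarith
  have hpa : ‖p‖ * ‖a‖ ≤ 10 * L ^ 4 := by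
    calc _ ≤ L * (10 * L ^ 3) := by gcongr
      _ = _ := by ring
  have hqa : ‖q‖ * ‖a‖ ≤ 10 * L ^ 4 := by
    calc _ ≤ L * (10 * L ^ 3) := by gcongr
      _ = _ := by ring
  have hpq : (‖p‖ * ‖a‖) * (‖q‖ * ‖a‖) ≤ 100 * L ^ 8 := by
    calc _ ≤ (10 * L ^ 4) * (10 * L ^ 4) := by gcongr
      _ = _ := by ring
  have hs2 : 2500 * L ^ 8 ≤ ‖s‖ ^ 2 := by
    calc _ = (50 * L ^ 4) ^ 2 := by ring
      _ ≤ _ := by gcongr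
  have hDl : ‖s‖ ^ 2 / 4 ≤ ‖D‖ + 4 * ((‖p‖ * ‖a‖) * (‖q‖ * ‖a‖)) := by
    have e1 : s ^ 2 / 4 = 4 * ((p * a) * (q * a)) - D := by rw [h1]; ring
    have := norm_sub_le (4 * ((p * a) * (q * a))) D
    rw [← e1] at this
    simp only [norm_mul, norm_div, norm_pow, Complex.norm_ofNat] at this
    linarith
  have hΔl : ‖D‖ ≤ ‖Δ‖ + 4 * (‖q‖ * ‖a‖) + L := by
    have e1 : D = Δ + 4 * (q * a) + g := by rw [h2]; ring
    have := norm_add_le (Δ + 4 * (q * a)) g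
    have h' := norm_add_le Δ (4 * (q * a))
    rw [← e1] at this
    simp [norm_mul] at h'
    linarith
  have hL4 : 16 ≤ L ^ 4 := by
    calc (16 : ℝ) = 2 ^ 4 := by norm_num
      _ ≤ _ := by gcongr
  have hLL4 : L ≤ L ^ 4 := le_self_pow₀ (by linarith) (by norm_num)
  have hL8 : 16 * L ^ 4 ≤ L ^ 8 := by nlinarith
  have hD8 : 8 ≤ ‖D‖ := by nlinarith
  have hΔ8 : 8 ≤ ‖Δ‖ := by nlinarith
  have hKe : K - 1 = D⁻¹ - 2 * Δ⁻¹ := by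
    field_simp
    linear_combination h4
  have hi1 : ‖D‖⁻¹ ≤ 1 / 8 := by
    rw [inv_le_comm₀ (by linarith) (by norm_num)]; norm_num; exact hD8
  have hi2 : ‖Δ‖⁻¹ ≤ 1 / 8 := by
    rw [inv_le_comm₀ (by linarith) (by norm_num)]; norm_num; exact hΔ8
  have hK : ‖K - 1‖ ≤ 1 / 2 := by
    rw [hKe]
    refine (norm_sub_le _ _).trans ?_
    simp only [norm_mul, norm_inv, Complex.norm_ofNat]
    linarith
  have hK2 : 1 / 2 ≤ ‖2 - K‖ := by
    have := norm_sub_norm_le 1 (K - 1)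
    rw [show (1 : ℂ) - (K - 1) = 2 - K by ring] at this
    simp only [norm_one] at this
    linarith
  have n5 := congrArg norm h5
  simp only [norm_mul, Complex.norm_ofNat] at n5
  nlinarith [norm_nonneg s]

set_option maxHeartbeats 2000000 in
/-- Step 3: `Δ` is bounded below. -/
lemma step_Δ (L : ℝ) (hL : 2 ≤ L) (p q g a s D Δ K e : ℂ)
    (hp : ‖p‖ ≤ L) (hq : ‖q‖ ≤ L) (hg : ‖g‖ ≤ L) (he : ‖e‖ ≤ L)
    (hp' : 1 ≤ L * ‖p‖) (hq' : 1 ≤ L * ‖q‖) (hg' : 1 ≤ L * ‖g‖)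
    (h0 : p * g + q = 1)
    (h1 : D = 4 * p * q * a ^ 2 - s ^ 2 / 4) (h2 : Δ = D - 4 * q * a - g)
    (h3 : K * p * a * Δ = -1) (h4 : K * D * Δ = D * Δ + Δ - 2 * D)
    (h5 : s * (2 - K) = 2 * e) (ha : ‖a‖ ≤ 10 * L ^ 3) :
    1 / (1000000 * L ^ 16) ≤ ‖Δ‖ := by
  by_contra! hlt
  have hLp : 0 < L := by linarith
  have hL1 : 1 ≤ L := by linarith
  have h6 : p * a * (Δ * (D + 1)) = (2 * p * a - 1) * D := by
    linear_combination (-p * a) * h4 + D * h3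
  have hδ : ‖Δ‖ * L ^ 16 ≤ 1 / 1000000 := by
    rw [lt_div_iff₀ (by positivity)] at hlt
    linarith
  have hpow : ∀ k : ℕ, k ≤ 16 → ‖Δ‖ * L ^ k ≤ 1 / 1000000 := by
    intro k hk
    refine le_trans ?_ hδ
    gcongr
  have hpa : ‖p‖ * ‖a‖ ≤ 10 * L ^ 4 := by
    calc _ ≤ L * (10 * L ^ 3) := by gcongr
      _ = _ := by ring
  have hqa : ‖q‖ * ‖a‖ ≤ 10 * L ^ 4 := by
    calc _ ≤ L * (10 * L ^ 3) := by gcongr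
      _ = _ := by ring
  have hKl : 1 ≤ ‖K‖ * (10 * L ^ 4 * ‖Δ‖) := by
    have := congrArg norm h3
    simp [norm_mul] at this
    calc (1 : ℝ) = ‖K‖ * (‖p‖ * ‖a‖ * ‖Δ‖) := by linarith
      _ ≤ _ := by gcongr
  have n5 := congrArg norm h5
  simp only [norm_mul, Complex.norm_ofNat] at n5
  have hK2 : ‖K‖ - 2 ≤ ‖2 - K‖ := by
    have := norm_sub_norm_le K 2
    rw [norm_sub_rev] at this
    simpa using this
  -- `‖s‖ ≤ 1 / (64 L ^ 6)`
  have hKbig : 1000 * L ^ 7 ≤ ‖K‖ := by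
    have h11 := hpow 11 (by norm_num)
    have : 1000 * L ^ 7 * 1 ≤ 1000 * L ^ 7 * (‖K‖ * (10 * L ^ 4 * ‖Δ‖)) := by gcongr
    have e2 : 1000 * L ^ 7 * (‖K‖ * (10 * L ^ 4 * ‖Δ‖)) = ‖K‖ * (10000 * (‖Δ‖ * L ^ 11)) := by ring
    rw [e2] at this
    nlinarith [norm_nonneg K]
  have hL7 : 1 ≤ L ^ 7 := one_le_pow₀ hL1
  have hL6 : 1 ≤ L ^ 6 := one_le_pow₀ hL1
  have hK3 : 500 * L ^ 7 ≤ ‖2 - K‖ := by linarith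
  have hs : ‖s‖ * L ^ 6 ≤ 1 / 64 := by
    have : ‖s‖ * (500 * L ^ 7) ≤ 2 * L := by
      calc _ ≤ ‖s‖ * ‖2 - K‖ := by gcongr
        _ ≤ _ := by linarith
    have : L * (‖s‖ * L ^ 6 * 500) ≤ L * 2 := by nlinarith
    have := le_of_mul_le_mul_left this hLp
    linarith
  have hs1 : ‖s‖ ≤ 1 / 64 := by nlinarith [norm_nonneg s]
  have hsL : ‖s‖ * L ≤ 1 / 64 := by
    refine le_trans ?_ hs
    gcongr
    exact le_self_pow₀ hL1 (by norm_num)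
  -- `u`
  have hu : q * (2 * p * a - 1) ^ 2 = 1 + p * (Δ + s ^ 2 / 4) := by
    rw [h2, h1]
    linear_combination h0
  have hul : 1 / 2 ≤ L * ‖2 * p * a - 1‖ ^ 2 := by
    have := norm_sub_norm_le 1 (-(p * (Δ + s ^ 2 / 4)))
    rw [sub_neg_eq_add, ← hu] at this
    simp only [norm_mul, norm_neg, norm_one, norm_pow] at this
    have hr : ‖Δ + s ^ 2 / 4‖ ≤ ‖Δ‖ + ‖s‖ / 4 := by
      refine (norm_add_le _ _).trans ?_
      simp only [norm_div, norm_pow, Complex.norm_ofNat]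
      nlinarith [norm_nonneg s]
    have : ‖p‖ * ‖Δ + s ^ 2 / 4‖ ≤ L * (‖Δ‖ + ‖s‖ / 4) := by gcongr
    have h11 := hpow 1 (by norm_num)
    have : ‖q‖ * ‖2 * p * a - 1‖ ^ 2 ≤ L * ‖2 * p * a - 1‖ ^ 2 := by gcongr
    nlinarith
  have hul' : 1 ≤ 2 * L * ‖2 * p * a - 1‖ := by
    by_contra! hc
    nlinarith [norm_nonneg (2 * p * a - 1)]
  have hL4 : 1 ≤ L ^ 4 := one_le_pow₀ hL1
  have hLL4 : L ≤ L ^ 4 := le_self_pow₀ hL1 (by norm_num)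
  have h00 := hpow 0 (by norm_num)
  have hDu : ‖D + 1‖ ≤ 50 * L ^ 4 := by
    have e1 : D + 1 = Δ + 4 * (q * a) + g + 1 := by rw [h2]; ring
    rw [e1]
    have a1 := norm_add_le (Δ + 4 * (q * a) + g) 1
    have a2 := norm_add_le (Δ + 4 * (q * a)) g
    have a3 := norm_add_le Δ (4 * (q * a))
    simp only [norm_mul, Complex.norm_ofNat, norm_one] at a1 a3
    linarith
  have hDs : ‖D‖ ≤ 1000 * (‖Δ‖ * L ^ 9) := by
    have n6 := congrArg norm h6
    rw [norm_mul (2 * p * a - 1) D] at n6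
    have : ‖p * a * (Δ * (D + 1))‖ ≤ 10 * L ^ 4 * (‖Δ‖ * (50 * L ^ 4)) := by
      rw [norm_mul, norm_mul, norm_mul]
      gcongr
    calc ‖D‖ = 1 * ‖D‖ := by ring
      _ ≤ 2 * L * ‖2 * p * a - 1‖ * ‖D‖ := by gcongr
      _ = 2 * L * (‖2 * p * a - 1‖ * ‖D‖) := by ring
      _ ≤ 2 * L * (10 * L ^ 4 * (‖Δ‖ * (50 * L ^ 4))) := by
          rw [← n6]
          exact mul_le_mul_of_nonneg_left this (by positivity)
      _ = _ := by ring
  have hDL6 : ‖D‖ * L ^ 6 ≤ 1 / 1000 := by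
    have := hpow 15 (by norm_num)
    calc ‖D‖ * L ^ 6 ≤ 1000 * (‖Δ‖ * L ^ 9) * L ^ 6 := by gcongr
      _ = 1000 * (‖Δ‖ * L ^ 15) := by ring
      _ ≤ _ := by linarith
  have hDL : ‖D‖ * L ≤ 1 / 1000 := by
    refine le_trans ?_ hDL6
    gcongr
    exact le_self_pow₀ hL1 (by norm_num)
  -- lower bound on `a`
  have hal : 1 / 8 ≤ L ^ 2 * ‖a‖ := by
    have e1 : g = D - Δ - 4 * (q * a) := by rw [h2]; ring
    have a1 := norm_sub_le (D - Δ) (4 * (q * a))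
    have a2 := norm_sub_le D Δ
    rw [← e1] at a1
    simp only [norm_mul, Complex.norm_ofNat] at a1
    have : ‖q‖ * ‖a‖ ≤ L * ‖a‖ := by gcongr
    have h11 := hpow 1 (by norm_num)
    nlinarith
  have hau : 4 * ‖a‖ ^ 2 ≤ L ^ 2 * (‖D‖ + ‖s‖) := by
    have e1 : 4 * (p * q * a ^ 2) = D + s ^ 2 / 4 := by rw [h1]; ring
    have a1 := norm_add_le D (s ^ 2 / 4)
    rw [← e1] at a1
    simp only [norm_mul, norm_div, norm_pow, Complex.norm_ofNat] at a1
    have hs' : ‖s‖ ^ 2 / 4 ≤ ‖s‖ := by nlinarith [norm_nonneg s]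
    have hpq : 1 ≤ (L * ‖p‖) * (L * ‖q‖) := one_le_mul_of_one_le_of_one_le hp' hq'
    calc 4 * ‖a‖ ^ 2 = 1 * (4 * ‖a‖ ^ 2) := by ring
      _ ≤ (L * ‖p‖) * (L * ‖q‖) * (4 * ‖a‖ ^ 2) := by gcongr
      _ = L ^ 2 * (4 * (‖p‖ * ‖q‖ * ‖a‖ ^ 2)) := by ring
      _ ≤ _ := by gcongr; linarith
  have f1 : (1 / 8 : ℝ) ^ 2 ≤ (L ^ 2 * ‖a‖) ^ 2 := by gcongr
  have f2 : L ^ 4 * (4 * ‖a‖ ^ 2) ≤ L ^ 4 * (L ^ 2 * (‖D‖ + ‖s‖)) := by gcongr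
  nlinarith

/-- The scalar equations encoded in the matrix equation. -/
lemma scalar_eqs (γ : ℝ) (hγ : 0 < γ) (z : ℂ) (hz : z ≠ 0) (E : ℝ)
    (m : Matrix (Fin 2) (Fin 2) ℂ) (hm : IsUnit m.det)
    (hT1 : IsUnit (T1 γ z m).det) (hT2 : IsUnit (T2 γ m).det)
    (heq : m⁻¹ - (E : ℂ) • sigma1 - (T1 γ z m)⁻¹ - (T2 γ m)⁻¹ + sigma1 * m * sigma1 = 0)
    (hsym : m 1 1 = 4 * (γ : ℂ) ^ 2 * z * m 0 0) :
    ∃ K : ℂ,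
      m 0 1 - m 1 0 = -(Complex.I / γ) * m 1 1 ∧
      m.det = 4 * ((γ : ℂ) ^ 2 * z) * (1 - z) * (m 0 0) ^ 2 - (m 0 1 + m 1 0) ^ 2 / 4 ∧
      (T1 γ z m).det = m.det - 4 * (1 - z) * m 0 0 - 1 / (γ : ℂ) ^ 2 ∧
      K * ((γ : ℂ) ^ 2 * z) * m 0 0 * (T1 γ z m).det = -1 ∧
      K * m.det * (T1 γ z m).det =
        m.det * (T1 γ z m).det + (T1 γ z m).det - 2 * m.det ∧
      (m 0 1 + m 1 0) * (2 - K) = 2 * (E : ℂ) := by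
  have hg0 : (γ : ℂ) ≠ 0 := by exact_mod_cast hγ.ne'
  have hI : Complex.I ^ 2 = -1 := Complex.I_sq
  obtain ⟨a, b, c, d, rfl⟩ : ∃ a b c d : ℂ, m = !![a, b; c, d] :=
    ⟨m 0 0, m 0 1, m 1 0, m 1 1, by ext i j; fin_cases i <;> fin_cases j <;> rfl⟩
  simp only [Matrix.of_apply, Matrix.cons_val', Matrix.cons_val_zero, Matrix.cons_val_one,
    Matrix.cons_val_fin_one] at hsym ⊢
  have hdet12 : (T2 γ !![a, b; c, d]).det = (T1 γ z !![a, b; c, d]).det := by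
    simp [T1, T2, Matrix.det_fin_two, hsym]
    field_simp
  have hΔ0 := hT1.ne_zero
  have hD0 := hm.ne_zero
  have i0 := congrFun (congrFun heq 0) 0
  have i1 := congrFun (congrFun heq 0) 1
  have i2 := congrFun (congrFun heq 1) 0
  rw [Matrix.inv_def, Matrix.inv_def, Matrix.inv_def, hdet12] at i0 i1 i2
  have hΔe : (T1 γ z !![a, b; c, d]).det =
      (!![a, b; c, d] : Matrix (Fin 2) (Fin 2) ℂ).det - 4 * a + Complex.I / γ * (b - c)
        - 1 / (γ : ℂ) ^ 2 := by
    simp [T1, Matrix.det_fin_two, hsym]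
    field_simp
    linear_combination (1 : ℂ) * hI
  have hDe : (!![a, b; c, d] : Matrix (Fin 2) (Fin 2) ℂ).det = a * d - b * c := by
    simp [Matrix.det_fin_two]
  generalize (T1 γ z !![a, b; c, d]).det = Δ at *
  generalize (!![a, b; c, d] : Matrix (Fin 2) (Fin 2) ℂ).det = D at *
  simp [T1, T2, sigma1, Matrix.adjugate_fin_two, Matrix.mul_apply, Fin.sum_univ_two] at i0 i1 i2
  set w : ℂ := Complex.I / γ with hw
  have hw2 : w * w * (γ : ℂ) ^ 2 = -1 := by
    rw [hw]; field_simp; exact hI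
  set K : ℂ := 1 + 1 / D - 2 / Δ with hK
  have k1 : d * K * Δ = -4 := by
    rw [hK]; field_simp at i0 ⊢; linear_combination i0
  have k2 : (b - c) * K * Δ = 4 * w := by
    rw [hK]
    have := congrArg₂ (fun x y => x - y) i1 i2
    field_simp at this ⊢
    linear_combination -this
  have k3 : (b + c) * (2 - K) = 2 * (E : ℂ) := by
    rw [hK]
    have := congrArg₂ (fun x y => x + y) i1 i2
    field_simp at this ⊢
    linear_combination this
  have hK0 : K ≠ 0 := by
    intro h; rw [h] at k1; norm_num at k1
  have ht : b - c = -w * d := by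
    have : (b - c + w * d) * (K * Δ) = 0 := by linear_combination k2 + w * k1
    have := (mul_eq_zero.mp this).resolve_right (mul_ne_zero hK0 hΔ0)
    linear_combination this
  refine ⟨K, ht, ?_, ?_, ?_, ?_, k3⟩
  · rw [hDe]
    have : b * c = ((b + c) ^ 2 - (b - c) ^ 2) / 4 := by ring
    rw [this, ht, hsym]
    linear_combination (4 * (γ : ℂ) ^ 2 * z ^ 2 * a ^ 2) * hw2
  · rw [hΔe, ht, hsym]
    linear_combination (-4 * z * a) * hw2
  · rw [hsym] at k1
    linear_combination k1 / 4
  · rw [hK]; field_simp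

theorem solution_bounded_away_from_special_points
    (γ : ℝ) (hγ : 0 < γ) (ε : ℝ) (hε : ε ∈ Set.Ioo (0 : ℝ) (1 / 2)) :
    ∃ C : ℝ, 0 < C ∧
      ∀ (z : ℂ), 0 < z.im → ε ≤ ‖z‖ → ‖z‖ ≤ 1 / ε →
        ε ≤ ‖1 - z‖ →
      ∀ (E : ℝ), |E| ≤ 1 / ε →
      ∀ (m : Matrix (Fin 2) (Fin 2) ℂ), IsUnit m.det →
        IsUnit (T1 γ z m).det → IsUnit (T2 γ m).det →
        m⁻¹ - (E : ℂ) • sigma1 - (T1 γ z m)⁻¹ - (T2 γ m)⁻¹ + sigma1 * m * sigma1 = 0 →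
        m 1 1 = 4 * (γ : ℂ) ^ 2 * z * m 0 0 →
        opNorm m ≤ C ∧ 1 / C ≤ ‖(T1 γ z m).det‖ := by
  obtain ⟨hε0, -⟩ := hε
  obtain ⟨L, hL2, l1, l2, l3, l4, l5, l6, l7⟩ : ∃ L : ℝ, 2 ≤ L ∧ γ ^ 2 * (1 / ε) ≤ L ∧
      1 + 1 / ε ≤ L ∧ 1 / γ ^ 2 ≤ L ∧ 1 / (γ ^ 2 * ε) ≤ L ∧ γ ^ 2 ≤ L ∧ 1 / ε ≤ L ∧
      1 / γ ≤ L := by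
    refine ⟨2 + γ ^ 2 * (1 / ε) + (1 + 1 / ε) + 1 / γ ^ 2 + 1 / (γ ^ 2 * ε) + γ ^ 2 + 1 / γ,
      ?_⟩
    have p1 : 0 < γ ^ 2 * (1 / ε) := by positivity
    have p2 : 0 < 1 / ε := by positivity
    have p3 : 0 < 1 / γ ^ 2 := by positivity
    have p4 : 0 < 1 / (γ ^ 2 * ε) := by positivity
    have p5 : 0 < γ ^ 2 := by positivity
    have p6 : 0 < 1 / γ := by positivity
    refine ⟨?_, ?_, ?_, ?_, ?_, ?_, ?_, ?_⟩ <;> linarith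
  have hLp : 0 < L := by linarith
  have hL1 : 1 ≤ L := by linarith
  refine ⟨1000000 * L ^ 16, by positivity, ?_⟩
  intro z _ hz1 hz2 hz3 E hE m hm hT1 hT2 heq hsym
  have hz : z ≠ 0 := by
    rintro rfl; simp at hz1; linarith
  obtain ⟨K, ht, h1, h2, h3, h4, h5⟩ := scalar_eqs γ hγ z hz E m hm hT1 hT2 heq hsym
  have hg0 : (γ : ℂ) ≠ 0 := by exact_mod_cast hγ.ne'
  have np : ‖(γ : ℂ) ^ 2 * z‖ = γ ^ 2 * ‖z‖ := by
    simp [norm_mul]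
  have ng : ‖1 / (γ : ℂ) ^ 2‖ = 1 / γ ^ 2 := by simp
  have hp : ‖(γ : ℂ) ^ 2 * z‖ ≤ L := by
    rw [np]; refine le_trans ?_ l1; gcongr
  have hq : ‖1 - z‖ ≤ L := by
    have := norm_sub_le 1 z
    simp only [norm_one] at this
    linarith
  have hg : ‖1 / (γ : ℂ) ^ 2‖ ≤ L := by rw [ng]; exact l3
  have he : ‖(E : ℂ)‖ ≤ L := by
    rw [Complex.norm_real, Real.norm_eq_abs]; linarith
  have hp' : 1 ≤ L * ‖(γ : ℂ) ^ 2 * z‖ := by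
    rw [np]
    calc (1 : ℝ) = 1 / (γ ^ 2 * ε) * (γ ^ 2 * ε) := by field_simp
      _ ≤ L * (γ ^ 2 * ‖z‖) := by gcongr
  have hq' : 1 ≤ L * ‖1 - z‖ := by
    calc (1 : ℝ) = 1 / ε * ε := by field_simp
      _ ≤ L * ‖1 - z‖ := by gcongr
  have hg' : 1 ≤ L * ‖1 / (γ : ℂ) ^ 2‖ := by
    rw [ng]
    calc (1 : ℝ) = γ ^ 2 * (1 / γ ^ 2) := by field_simp
      _ ≤ _ := by gcongr
  have h0 : (γ : ℂ) ^ 2 * z * (1 / (γ : ℂ) ^ 2) + (1 - z) = 1 := by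
    field_simp; ring
  have ha := step_a L hL2 _ _ _ _ _ _ _ K E hp hq hg he hp' hq' hm.ne_zero h1 h2 h3 h4 h5
  have hs := step_s L hL2 _ _ _ _ _ _ _ K E hp hq hg he hm.ne_zero hT1.ne_zero h1 h2 h4 h5 ha
  refine ⟨?_, step_Δ L hL2 _ _ _ _ _ _ _ K E hp hq hg he hp' hq' hg' h0 h1 h2 h3 h4 h5 ha⟩
  refine (opNorm_le_entries m).trans ?_
  have hd : ‖m 1 1‖ ≤ 40 * L ^ 4 := by
    rw [hsym, show 4 * (γ : ℂ) ^ 2 * z * m 0 0 = 4 * (((γ : ℂ) ^ 2 * z) * m 0 0) by ring,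
      norm_mul, norm_mul]
    simp only [Complex.norm_ofNat]
    calc 4 * (‖(γ : ℂ) ^ 2 * z‖ * ‖m 0 0‖) ≤ 4 * (L * (10 * L ^ 3)) := by gcongr
      _ = _ := by ring
  have htn : ‖m 0 1 - m 1 0‖ ≤ 40 * L ^ 5 := by
    rw [ht, norm_mul, norm_neg]
    have : ‖Complex.I / (γ : ℂ)‖ ≤ L := by
      simp only [norm_div, Complex.norm_I, Complex.norm_real, Real.norm_eq_abs, abs_of_pos hγ]
      exact l7
    calc _ ≤ L * (40 * L ^ 4) := by gcongr
      _ = _ := by ring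
  have hb : ‖m 0 1‖ ≤ 50 * L ^ 4 + 40 * L ^ 5 := by
    have := norm_add_le (m 0 1 + m 1 0) (m 0 1 - m 1 0)
    rw [show m 0 1 + m 1 0 + (m 0 1 - m 1 0) = 2 * m 0 1 by ring, norm_mul] at this
    simp only [Complex.norm_ofNat] at this
    linarith [norm_nonneg (m 0 1)]
  have hc : ‖m 1 0‖ ≤ 50 * L ^ 4 + 40 * L ^ 5 := by
    have := norm_sub_le (m 0 1 + m 1 0) (m 0 1 - m 1 0)
    rw [show m 0 1 + m 1 0 - (m 0 1 - m 1 0) = 2 * m 1 0 by ring, norm_mul] at this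
    simp only [Complex.norm_ofNat] at this
    linarith [norm_nonneg (m 1 0)]
  have q3 : L ^ 3 ≤ L ^ 16 := pow_le_pow_right₀ hL1 (by norm_num)
  have q4 : L ^ 4 ≤ L ^ 16 := pow_le_pow_right₀ hL1 (by norm_num)
  have q5 : L ^ 5 ≤ L ^ 16 := pow_le_pow_right₀ hL1 (by norm_num)
  have q0 : 0 < L ^ 16 := by positivity
  linarith

end
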